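/- arXiv:1709.00598 — 7 statements merged into one kernel-verified Lean document; each statement's English description precedes it below -/
import Mathlib

section
/- Let q be a prime power, m, n, k natural numbers with 1 ≤ k ≤ n ≤ m, and let C ≤ F_{q^m}^n be an F_{q^m}-linear rank metric code of dimension k and minimum distance d. Then the generalized rank weights of C form a strictly increasing sequence: d(C) = d_1(C) < d_2(C) < … < d_k(C). -/
open Polynomial

/-- The `q`-ary Gaussian binomial coefficient `[a choose b]_q`. -/
def gaussBinom (q a b : ℕ) : ℕ :=
  if b ≤ a then
    (∏ i ∈ Finset.range b, (q ^ (a - i) - 1)) / (∏ i ∈ Finset.range b, (q ^ (i + 1) - 1))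
  else 0

section Dual

variable (K : Type) [Field K] {n : ℕ}

/-- The linear functional `v ↦ ∑ i, u i * v i` given by the standard inner product. -/
def dotL (u : Fin n → K) : (Fin n → K) →ₗ[K] K where
  toFun v := ∑ i, u i * v i
  map_add' a b := by simp [mul_add, Finset.sum_add_distrib]
  map_smul' c a := by simp [Finset.mul_sum, mul_left_comm]

/-- The dual code with respect to the standard inner product. -/
def dualCode (C : Submodule K (Fin n → K)) : Submodule K (Fin n → K) :=
  ⨅ u ∈ C, LinearMap.ker (dotL K u)

end Dual

section RankMetric

variable (Fq K : Type) [Field Fq] [Field K] [Algebra Fq K] {n : ℕ}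

/-- The rank weight of a vector `v ∈ K^n`, `K = F_{q^m}`, over `Fq`. -/
noncomputable def rankWt (v : Fin n → K) : ℕ :=
  Module.finrank Fq (Submodule.span Fq (Set.range v))

/-- The support of `v ∈ K^n`: the `Fq`-subspace of `Fq^n` of all coordinatewise
images of `v` under `Fq`-linear functionals of `K`. -/
def rsupp (v : Fin n → K) : Submodule Fq (Fin n → Fq) :=
  Submodule.span Fq {w : Fin n → Fq | ∃ f : K →ₗ[Fq] Fq, w = fun i => f (v i)}

/-- The support of an `K`-linear code `C ≤ K^n`. -/
def codeSupp (C : Submodule K (Fin n → K)) : Submodule Fq (Fin n → Fq) :=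
  ⨆ v ∈ C, rsupp Fq K v

/-- `C` has minimum rank distance `d`. -/
def IsMinRankDist (C : Submodule K (Fin n → K)) (d : ℕ) : Prop :=
  (∃ c ∈ C, c ≠ 0 ∧ rankWt Fq K c = d) ∧ ∀ c ∈ C, c ≠ 0 → d ≤ rankWt Fq K c

/-- The `r`-th generalized rank weight of `C`. -/
noncomputable def genRankWt (C : Submodule K (Fin n → K)) (r : ℕ) : ℕ :=
  sInf {w | ∃ D : Submodule K (Fin n → K), D ≤ C ∧ Module.finrank K D = r ∧
    Module.finrank Fq (codeSupp Fq K D) = w}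

end RankMetric

/-- A `q`-Steiner system `S_q(t,k,n)` with block set `B`: every block is a
`k`-dimensional `Fq`-subspace of `Fq^n`, and every `t`-dimensional subspace is
contained in exactly one block. -/
def IsSteinerSystemQ (Fq : Type) [Field Fq] (t k n : ℕ)
    (B : Set (Submodule Fq (Fin n → Fq))) : Prop :=
  (∀ b ∈ B, Module.finrank Fq b = k) ∧
  ∀ W : Submodule Fq (Fin n → Fq), Module.finrank Fq W = t → ∃! b, b ∈ B ∧ W ≤ b

section RankMetricLemmas

variable {Fq K : Type} [Field Fq] [Field K] [Algebra Fq K] {n : ℕ}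

/-- The support of `v` is the range of the map `f ↦ (f (v i))ᵢ` on the dual of `K`. -/
theorem rsupp_eq_range (v : Fin n → K) :
    rsupp Fq K v = LinearMap.range (LinearMap.pi fun i => Module.Dual.eval Fq K (v i)) := by
  have h : {w : Fin n → Fq | ∃ f : K →ₗ[Fq] Fq, w = fun i => f (v i)} =
      (LinearMap.range (LinearMap.pi fun i => Module.Dual.eval Fq K (v i)) :
        Set (Fin n → Fq)) := by
    ext w
    constructor
    · rintro ⟨f, rfl⟩
      exact ⟨f, rfl⟩
    · rintro ⟨f, rfl⟩
      exact ⟨f, rfl⟩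
  rw [rsupp, h, Submodule.span_eq]

theorem finrank_rsupp [FiniteDimensional Fq K] (v : Fin n → K) :
    Module.finrank Fq (rsupp Fq K v) = rankWt Fq K v := by
  have hker : LinearMap.ker (LinearMap.pi fun i => Module.Dual.eval Fq K (v i)) =
      (Submodule.span Fq (Set.range v)).dualAnnihilator := by
    ext f
    rw [Submodule.mem_dualAnnihilator, LinearMap.mem_ker]
    constructor
    · intro h x hx
      have hle : Submodule.span Fq (Set.range v) ≤ LinearMap.ker f := by
        rw [Submodule.span_le]
        rintro _ ⟨i, rfl⟩
        exact congrFun h i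
      exact hle hx
    · intro h
      funext i
      exact h _ (Submodule.subset_span ⟨i, rfl⟩)
  have h₁ := LinearMap.finrank_range_add_finrank_ker
    (LinearMap.pi fun i => Module.Dual.eval Fq K (v i))
  have h₂ := Subspace.finrank_add_finrank_dualAnnihilator_eq (Submodule.span Fq (Set.range v))
  rw [hker, ← rsupp_eq_range, Subspace.dual_finrank_eq] at h₁
  rw [rankWt]
  omega

theorem rsupp_smul_le (c : K) (v : Fin n → K) : rsupp Fq K (c • v) ≤ rsupp Fq K v := by
  refine Submodule.span_le.2 ?_
  rintro _ ⟨f, rfl⟩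
  exact Submodule.subset_span ⟨f ∘ₗ LinearMap.mulLeft Fq c, rfl⟩

theorem rsupp_le_codeSupp {D : Submodule K (Fin n → K)} {v : Fin n → K} (hv : v ∈ D) :
    rsupp Fq K v ≤ codeSupp Fq K D :=
  le_iSup₂_of_le v hv le_rfl

theorem codeSupp_mono {D E : Submodule K (Fin n → K)} (h : D ≤ E) :
    codeSupp Fq K D ≤ codeSupp Fq K E :=
  iSup₂_le fun _ hv => rsupp_le_codeSupp (h hv)

theorem codeSupp_span_singleton (v : Fin n → K) :
    codeSupp Fq K (Submodule.span K {v}) = rsupp Fq K v := by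
  refine le_antisymm (iSup₂_le fun u hu => ?_)
    (rsupp_le_codeSupp (Submodule.mem_span_singleton_self v))
  obtain ⟨c, rfl⟩ := Submodule.mem_span_singleton.1 hu
  exact rsupp_smul_le c v

/-- A nonzero code contains a subcode of codimension one with strictly smaller support: the
words vanishing at a coordinate where the code does not vanish identically. -/
theorem exists_subcode_codeSupp_lt {D : Submodule K (Fin n → K)} {r : ℕ}
    (hD : Module.finrank K D = r + 1) :
    ∃ E ≤ D, Module.finrank K E = r ∧ codeSupp Fq K E < codeSupp Fq K D := by
  have hD0 : D ≠ ⊥ := by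
    rintro rfl
    simp at hD
  obtain ⟨v, hvD, hv0⟩ := D.ne_bot_iff.1 hD0
  obtain ⟨i, hi⟩ := Function.ne_iff.1 hv0
  let φ : D →ₗ[K] K := LinearMap.proj i ∘ₗ D.subtype
  have hφ : φ ≠ 0 := fun h => hi (LinearMap.congr_fun h ⟨v, hvD⟩)
  refine ⟨(LinearMap.ker φ).map D.subtype, Submodule.map_subtype_le _ _, ?_, ?_⟩
  · have h₁ := LinearMap.finrank_range_add_finrank_ker φ
    rw [LinearMap.range_eq_top.2 (LinearMap.surjective hφ), finrank_top, Module.finrank_self,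
      hD] at h₁
    rw [Submodule.finrank_map_subtype_eq]
    omega
  · refine lt_of_le_of_ne (codeSupp_mono (Submodule.map_subtype_le _ _)) fun heq => ?_
    have hle : codeSupp Fq K ((LinearMap.ker φ).map D.subtype) ≤
        LinearMap.ker (LinearMap.proj i : (Fin n → Fq) →ₗ[Fq] Fq) := by
      refine iSup₂_le fun u hu => Submodule.span_le.2 ?_
      rintro _ ⟨f, rfl⟩
      obtain ⟨x, hx, rfl⟩ := hu
      have hxi : (x : Fin n → K) i = 0 := hx
      simp [hxi]
    refine hi ((Module.forall_dual_apply_eq_zero_iff Fq (v i)).1 fun f => ?_)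
    exact hle (heq ▸ rsupp_le_codeSupp hvD (Submodule.subset_span ⟨f, rfl⟩))

end RankMetricLemmas

/-- The generalized rank weights of a `[n,k,d]` rank metric code
form a strictly increasing sequence `d = d_1 < d_2 < ⋯ < d_k`. -/
theorem generalized_rank_weights_strict_mono
    (Fq K : Type) [Field Fq] [Fintype Fq] [Field K] [Fintype K] [Algebra Fq K]
    (m n k d : ℕ) (hm : Module.finrank Fq K = m)
    (hk1 : 1 ≤ k) (hkn : k ≤ n) (hnm : n ≤ m)
    (C : Submodule K (Fin n → K)) (hdim : Module.finrank K C = k)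
    (hmin : IsMinRankDist Fq K C d) :
    genRankWt Fq K C 1 = d ∧
      ∀ r : ℕ, 1 ≤ r → r < k → genRankWt Fq K C r < genRankWt Fq K C (r + 1) := by
  have : FiniteDimensional Fq K := Module.Finite.of_finite
  constructor
  · obtain ⟨⟨c, hcC, hc0, hcd⟩, hle⟩ := hmin
    refine le_antisymm (Nat.sInf_le ⟨Submodule.span K {c}, ?_, finrank_span_singleton hc0, ?_⟩)
      (le_csInf ⟨_, Submodule.span K {c}, ?_, finrank_span_singleton hc0, rfl⟩ ?_)
    · simpa using hcC
    · rw [codeSupp_span_singleton, finrank_rsupp, hcd]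
    · simpa using hcC
    · rintro _ ⟨D, hDC, hD, rfl⟩
      have hD0 : D ≠ ⊥ := by
        rintro rfl
        simp at hD
      obtain ⟨v, hvD, hv0⟩ := D.ne_bot_iff.1 hD0
      calc d ≤ rankWt Fq K v := hle v (hDC hvD) hv0
        _ = Module.finrank Fq (rsupp Fq K v) := (finrank_rsupp v).symm
        _ ≤ _ := Submodule.finrank_mono (rsupp_le_codeSupp hvD)
  · intro r _ hrk
    obtain ⟨b, hb⟩ := exists_linearIndependent_of_le_finrank (R := K) (M := C)
      (n := r + 1) (by omega)
    have hfin : Module.finrank K ((Submodule.span K (Set.range b)).map C.subtype) = r + 1 := by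
      rw [Submodule.finrank_map_subtype_eq, finrank_span_eq_card hb, Fintype.card_fin]
    obtain ⟨D, hDC, hD, hw⟩ := Nat.sInf_mem
      (s := {w | ∃ D : Submodule K (Fin n → K), D ≤ C ∧ Module.finrank K D = r + 1 ∧
        Module.finrank Fq (codeSupp Fq K D) = w}) ⟨_, _, Submodule.map_subtype_le _ _, hfin, rfl⟩
    obtain ⟨E, hED, hE, hlt⟩ := exists_subcode_codeSupp_lt (Fq := Fq) hD
    calc genRankWt Fq K C r ≤ Module.finrank Fq (codeSupp Fq K E) :=
          Nat.sInf_le ⟨E, hED.trans hDC, hE, rfl⟩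
      _ < Module.finrank Fq (codeSupp Fq K D) := Submodule.finrank_lt_finrank_of_lt hlt
      _ = genRankWt Fq K C (r + 1) := hw
end

section
/- Let q be a prime power and let a, b be natural numbers with b < a. Then the q-ary Gaussian binomial coefficient satisfies [a choose b]_q = ∏_{j ∈ J_{a,b}} Φ_j(q), where J_{a,b} = { j ∈ {1,…,a} : ((a−b) mod j) + (b mod j) ≥ j } and Φ_j denotes the j-th cyclotomic polynomial evaluated at q. -/
open Polynomial

/-- The `q`-factorial product `∏_{i ≤ n} (x ^ i - 1)` as a product of cyclotomic values. -/
theorem prod_pow_succ_sub_one_eq_prod_cyclotomic {R : Type*} [CommRing R] (x : R) {n N : ℕ}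
    (h : n ≤ N) :
    ∏ i ∈ Finset.range n, (x ^ (i + 1) - 1) =
      ∏ j ∈ Finset.Icc 1 N, (cyclotomic j R).eval x ^ (n / j) := by
  induction n with
  | zero => simp
  | succ n ih =>
    have hdiv : (Finset.Icc 1 N).filter (fun j => j ∣ n + 1) = (n + 1).divisors := by
      ext j
      simp only [Finset.mem_filter, Finset.mem_Icc, Nat.mem_divisors]
      constructor
      · rintro ⟨-, hj⟩
        exact ⟨hj, n.succ_ne_zero⟩
      · rintro ⟨hj, -⟩
        exact ⟨⟨Nat.pos_of_dvd_of_pos hj n.succ_pos, (Nat.le_of_dvd n.succ_pos hj).trans h⟩, hj⟩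
    have hX : x ^ (n + 1) - 1 = ∏ j ∈ (n + 1).divisors, (cyclotomic j R).eval x := by
      rw [← eval_prod, prod_cyclotomic_eq_X_pow_sub_one n.succ_pos]
      simp
    rw [Finset.prod_range_succ, ih (by omega), hX, ← hdiv, Finset.prod_filter,
      ← Finset.prod_mul_distrib]
    refine Finset.prod_congr rfl fun j _ => ?_
    rw [Nat.succ_div]
    split_ifs <;> simp [pow_succ]

/-- Reversing the numerator of the Gaussian binomial coefficient completes a `q`-factorial. -/
theorem prod_range_mul_prod_range_pow_sub {R : Type*} [CommRing R] (x : R) {a b : ℕ}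
    (h : b ≤ a) :
    (∏ i ∈ Finset.range (a - b), (x ^ (i + 1) - 1)) * ∏ i ∈ Finset.range b, (x ^ (a - i) - 1) =
      ∏ i ∈ Finset.range a, (x ^ (i + 1) - 1) := by
  obtain ⟨c, rfl⟩ := Nat.exists_eq_add_of_le' h
  rw [Finset.prod_range_add, Nat.add_sub_cancel,
    ← Finset.prod_range_reflect (fun i => x ^ (c + i + 1) - 1)]
  congr 1
  refine Finset.prod_congr rfl fun i hi => ?_
  have := Finset.mem_range.mp hi
  rw [show c + (b - 1 - i) + 1 = c + b - i by omega]

/-- For `b < a`, the `q`-ary Gaussian binomial coefficient factors as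
`[a choose b]_q = ∏_{j ∈ J_{a,b}} Φ_j(q)` where
`J_{a,b} = { j ∈ {1,…,a} | (a-b) % j + b % j ≥ j }`. -/
theorem gaussBinom_eq_prod_cyclotomic (q : ℕ) (hq : IsPrimePow q)
    (a b : ℕ) (hba : b < a) :
    (gaussBinom q a b : ℤ) =
      ∏ j ∈ (Finset.Icc 1 a).filter (fun j => j ≤ (a - b) % j + b % j),
        (Polynomial.cyclotomic j ℤ).eval (q : ℤ) := by
  have hq1 : 1 < q := hq.one_lt
  have hcast (k : ℕ) : ((q ^ k - 1 : ℕ) : ℤ) = (q : ℤ) ^ k - 1 := by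
    rw [Nat.cast_sub (Nat.one_le_pow _ _ (by omega))]
    simp
  have hfac (n : ℕ) : ∏ i ∈ Finset.range n, ((q : ℤ) ^ (i + 1) - 1) ≠ 0 :=
    Finset.prod_ne_zero_iff.mpr fun i _ =>
      (sub_pos.mpr (one_lt_pow₀ (by exact_mod_cast hq1) i.succ_ne_zero)).ne'
  rw [gaussBinom, if_pos hba.le]
  push_cast [hcast]
  refine Int.ediv_eq_of_eq_mul_left (hfac b) (mul_left_cancel₀ (hfac (a - b)) ?_)
  rw [prod_range_mul_prod_range_pow_sub _ hba.le,
    prod_pow_succ_sub_one_eq_prod_cyclotomic _ le_rfl,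
    prod_pow_succ_sub_one_eq_prod_cyclotomic _ hba.le,
    prod_pow_succ_sub_one_eq_prod_cyclotomic _ (Nat.sub_le a b), Finset.prod_filter,
    ← Finset.prod_mul_distrib, ← Finset.prod_mul_distrib]
  refine Finset.prod_congr rfl fun j hj => ?_
  have hdiv := Nat.add_div (a := a - b) (b := b) (Finset.mem_Icc.mp hj).1
  rw [Nat.sub_add_cancel hba.le] at hdiv
  rw [hdiv]
  split_ifs <;> ring
end

section
/- Let q be a prime power, n ≤ m, and let C ≤ F_{q^m}^n be a nonzero F_{q^m}-linear rank metric code. Then there exists a codeword c ∈ C such that supp(c) = supp(C). -/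
open Polynomial

section SupportDuality

variable {Fq K : Type} [Field Fq] [Field K] [Algebra Fq K] {n : ℕ}

lemma dotL_comp_linearMap (x : Fin n → Fq) (f : K →ₗ[Fq] Fq) (v : Fin n → K) :
    dotL Fq x (fun i => f (v i)) = f (dotL K (fun i => algebraMap Fq K (x i)) v) := by
  simp [dotL, ← Algebra.smul_def]

/-- The orthogonal complement of `rsupp Fq K v` consists of the `Fq`-linear relations between
the coordinates of `v`. -/
lemma forall_mem_rsupp_dotL_eq_zero_iff (x : Fin n → Fq) (v : Fin n → K) :
    (∀ w ∈ rsupp Fq K v, dotL Fq x w = 0) ↔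
      dotL K (fun i => algebraMap Fq K (x i)) v = 0 := by
  refine ⟨fun h => ?_, fun h => ?_⟩
  · rw [← Module.forall_dual_apply_eq_zero_iff Fq]
    intro f
    rw [← dotL_comp_linearMap]
    exact h _ (Submodule.subset_span ⟨f, rfl⟩)
  · suffices rsupp Fq K v ≤ LinearMap.ker (dotL Fq x) from fun w hw => this hw
    refine Submodule.span_le.mpr ?_
    rintro _ ⟨f, rfl⟩
    simp [dotL_comp_linearMap, h]

lemma exists_eq_dotL (g : Module.Dual Fq (Fin n → Fq)) : ∃ x, g = dotL Fq x := by
  refine ⟨fun i => g (Pi.single i 1), LinearMap.ext fun w => ?_⟩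
  rw [LinearMap.pi_apply_eq_sum_univ g w]
  simp only [dotL, LinearMap.coe_mk, AddHom.coe_mk, smul_eq_mul]
  refine Finset.sum_congr rfl fun i _ => ?_
  rw [mul_comm]
  congr 2
  ext j
  simp [Pi.single_apply, eq_comm]

/-- Supports are compared by comparing the linear relations between coordinates. -/
lemma rsupp_le_rsupp {c v : Fin n → K}
    (h : ∀ x : Fin n → Fq, dotL K (fun i => algebraMap Fq K (x i)) c = 0 →
      dotL K (fun i => algebraMap Fq K (x i)) v = 0) :
    rsupp Fq K v ≤ rsupp Fq K c := by
  intro w hw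
  rw [← Subspace.forall_mem_dualAnnihilator_apply_eq_zero_iff]
  intro g hg
  obtain ⟨x, rfl⟩ := exists_eq_dotL g
  rw [Submodule.mem_dualAnnihilator, forall_mem_rsupp_dotL_eq_zero_iff] at hg
  exact (forall_mem_rsupp_dotL_eq_zero_iff x v).mpr (h x hg) w hw

end SupportDuality

/-- Fewer than `|K|` linear functionals, each nonzero somewhere on `C`, are simultaneously nonzero
at some point of `C`. -/
lemma exists_mem_forall_apply_ne_zero_of_card_lt {ι K V : Type*} [Fintype ι] [Field K]
    [AddCommGroup V] [Module K V] (C : Submodule K V) (f : ι → Module.Dual K V)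
    (h : ∀ i, ∃ v ∈ C, f i v ≠ 0) (hcard : Fintype.card ι < ENat.card K) :
    ∃ c ∈ C, ∀ i, f i c ≠ 0 := by
  have hp (i : ι) : LinearMap.ker ((f i).domRestrict C) ≠ ⊤ := by
    obtain ⟨v, hv, hne⟩ := h i
    intro htop
    exact hne (LinearMap.mem_ker.mp (htop ▸ Submodule.mem_top :
      (⟨v, hv⟩ : C) ∈ LinearMap.ker ((f i).domRestrict C)))
  have hU := Submodule.iUnion_ssubset_of_forall_ne_top_of_card_lt Finset.univ _ hp hcard
  obtain ⟨c, -, hc⟩ := Set.exists_of_ssubset hU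
  exact ⟨c, c.2, fun i hi => hc (Set.mem_biUnion (Finset.mem_univ i) hi)⟩

/-- A nonzero rank metric code contains a codeword whose support is
the support of the whole code. -/
theorem exists_codeword_supp_eq_codeSupp
    (Fq K : Type) [Field Fq] [Fintype Fq] [Field K] [Fintype K] [Algebra Fq K]
    (m n : ℕ) (hm : Module.finrank Fq K = m) (hnm : n ≤ m)
    (C : Submodule K (Fin n → K)) (hC : C ≠ ⊥) :
    ∃ c ∈ C, rsupp Fq K c = codeSupp Fq K C := by
  classical
  let ι := {x : Fin n → Fq // ∃ v ∈ C, dotL K (fun i => algebraMap Fq K (x i)) v ≠ 0}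
  have hcard : Fintype.card ι < Fintype.card K := calc
    Fintype.card ι < Fintype.card (Fin n → Fq) :=
      Fintype.card_subtype_lt (x := 0) (by simp [dotL])
    _ = Fintype.card Fq ^ n := by simp
    _ ≤ Fintype.card Fq ^ m := Nat.pow_le_pow_right Fintype.card_pos hnm
    _ = Fintype.card K := by rw [← hm, ← Module.card_eq_pow_finrank]
  obtain ⟨c, hc, hne⟩ := exists_mem_forall_apply_ne_zero_of_card_lt C
    (fun x : ι => dotL K (fun i => algebraMap Fq K (x.1 i))) (fun x => x.2)
    (by rw [ENat.card_eq_coe_fintype_card]; exact_mod_cast hcard)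
  refine ⟨c, hc, le_antisymm (le_iSup₂_of_le c hc le_rfl) (iSup₂_le fun v hv => ?_)⟩
  refine rsupp_le_rsupp fun x hx => ?_
  by_contra hxv
  exact hne ⟨x, v, hv, hxv⟩ hx
end

section
/- Let q be a prime power, n ≤ m, and let C ≤ F_{q^m}^n be an F_{q^m}-linear rank metric code with minimum distance d such that C has no codeword of rank weight d+1 (A_{d+1}(C) = 0). If u, v ∈ C both have rank weight d and supp(u) ≠ supp(v), then dim_{F_q}(supp(u) ∩ supp(v)) ≤ d − 2; in particular, no (d−1)-dimensional F_q-subspace of F_q^n is contained in two distinct supports of minimum-weight codewords of C. -/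
open Polynomial

/-- If the source is no larger than the field `K`, some combination `φ + α • ψ` has the smallest
possible kernel. -/
theorem exists_ker_add_smul_eq_inf {F K V : Type*} [Field F] [Field K] [Algebra F K]
    [AddCommGroup V] [Module F V] [Finite V] (hcard : Nat.card V ≤ Nat.card K)
    (φ ψ : V →ₗ[F] K) :
    ∃ α : K, LinearMap.ker (φ + α • ψ) = LinearMap.ker φ ⊓ LinearMap.ker ψ := by
  by_contra! hα
  have hex (α : K) : ∃ a : V, φ a + α * ψ a = 0 ∧ ψ a ≠ 0 := by
    by_contra! h
    refine hα α (le_antisymm (fun a ha => ?_) (fun a ha => ?_))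
    · have hz : φ a + α * ψ a = 0 := by simpa using ha
      have hψ := h a hz
      exact ⟨by simpa [hψ] using hz, hψ⟩
    · have hφ : φ a = 0 := ha.1
      have hψ : ψ a = 0 := ha.2
      simp [hφ, hψ]
  choose a hsum hψ using hex
  have hinj : Function.Injective a := by
    intro α β hαβ
    have h₁ := hsum α
    have h₂ := hsum β
    rw [← hαβ] at h₂
    exact mul_right_cancel₀ (hψ α) (add_left_cancel (h₁.trans h₂.symm))
  have hsurj := (hinj.bijective_of_nat_card_le hcard).2
  obtain ⟨α, h0⟩ := hsurj 0
  exact hψ α (by simp [h0])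

section RankMetric

variable (Fq K : Type) [Field Fq] [Field K] [Algebra Fq K] {n : ℕ}

/-- A functional on `Fq^n` as its vector of values on the standard basis. -/
noncomputable def dualCoords (n : ℕ) : Module.Dual Fq (Fin n → Fq) ≃ₗ[Fq] (Fin n → Fq) :=
  ((Pi.basisFun Fq (Fin n)).constr Fq).symm

theorem dualCoords_apply (f : Module.Dual Fq (Fin n → Fq)) (i : Fin n) :
    dualCoords Fq n f i = f (Pi.single i 1) := by
  simp [dualCoords, Module.Basis.constr]

theorem rankWt_eq_finrank_range (v : Fin n → K) :
    rankWt Fq K v = Module.finrank Fq (LinearMap.range (Fintype.linearCombination Fq v)) := by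
  rw [rankWt, Fintype.range_linearCombination]

theorem rankWt_add_finrank_ker (v : Fin n → K) :
    rankWt Fq K v + Module.finrank Fq (LinearMap.ker (Fintype.linearCombination Fq v)) = n := by
  rw [rankWt_eq_finrank_range, LinearMap.finrank_range_add_finrank_ker, Module.finrank_fin_fun]

/-- The support of `v` is the annihilator of the `Fq`-linear relations among its coordinates,
in coordinates. -/
theorem rsupp_eq_map_dualAnnihilator (v : Fin n → K) :
    rsupp Fq K v = (LinearMap.ker (Fintype.linearCombination Fq v)).dualAnnihilator.map
      (dualCoords Fq n).toLinearMap := by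
  rw [← LinearMap.range_dualMap_eq_dualAnnihilator_ker, ← LinearMap.range_comp, rsupp]
  have hset : {w : Fin n → Fq | ∃ f : K →ₗ[Fq] Fq, w = fun i => f (v i)} =
      LinearMap.range ((dualCoords Fq n).toLinearMap ∘ₗ
        (Fintype.linearCombination Fq v).dualMap) := by
    ext w
    simp only [Set.mem_ofPred_eq, SetLike.mem_coe, LinearMap.mem_range]
    refine exists_congr fun f => ?_
    rw [eq_comm]
    refine Eq.congr ?_ rfl
    ext i
    simp [dualCoords_apply]
  rw [hset, Submodule.span_eq]

theorem finrank_rsupp_inf_add_finrank_ker_sup (u v : Fin n → K) :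
    Module.finrank Fq ↥(rsupp Fq K u ⊓ rsupp Fq K v) +
      Module.finrank Fq ↥(LinearMap.ker (Fintype.linearCombination Fq u) ⊔
        LinearMap.ker (Fintype.linearCombination Fq v)) = n := by
  rw [rsupp_eq_map_dualAnnihilator, rsupp_eq_map_dualAnnihilator,
    ← Submodule.map_inf _ (dualCoords Fq n).injective, ← Submodule.dualAnnihilator_sup_eq,
    LinearEquiv.finrank_map_eq, add_comm, Subspace.finrank_add_finrank_dualAnnihilator_eq,
    Module.finrank_fin_fun]

end RankMetric

/-- If `C` has minimum distance `d` and no codeword of weight `d+1`,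
then distinct supports of minimum-weight codewords intersect in dimension at most
`d−2`; in particular no `(d−1)`-dimensional subspace lies in two distinct such
supports. -/
theorem inter_supports_le
    (Fq K : Type) [Field Fq] [Fintype Fq] [Field K] [Fintype K] [Algebra Fq K]
    (m n d : ℕ) (hm : Module.finrank Fq K = m) (hnm : n ≤ m)
    (C : Submodule K (Fin n → K)) (hmin : IsMinRankDist Fq K C d)
    (hA : ∀ c ∈ C, rankWt Fq K c ≠ d + 1)
    (u v : Fin n → K) (hu : u ∈ C) (hv : v ∈ C)
    (hwu : rankWt Fq K u = d) (hwv : rankWt Fq K v = d)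
    (hne : rsupp Fq K u ≠ rsupp Fq K v) :
    Module.finrank Fq ↥(rsupp Fq K u ⊓ rsupp Fq K v) ≤ d - 2 ∧
      ∀ W : Submodule Fq (Fin n → Fq), Module.finrank Fq W = d - 1 →
        ¬ (W ≤ rsupp Fq K u ∧ W ≤ rsupp Fq K v) := by
  have hcard : Nat.card (Fin n → Fq) ≤ Nat.card K := by
    rw [Module.natCard_eq_pow_finrank (K := Fq) (V := Fin n → Fq),
      Module.natCard_eq_pow_finrank (K := Fq) (V := K), Module.finrank_fin_fun, hm]
    exact Nat.pow_le_pow_right Nat.card_pos hnm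
  obtain ⟨α, hα⟩ := exists_ker_add_smul_eq_inf hcard
    (Fintype.linearCombination Fq u) (Fintype.linearCombination Fq v)
  have hlin : Fintype.linearCombination Fq u + α • Fintype.linearCombination Fq v =
      Fintype.linearCombination Fq (u + α • v) := by
    ext i
    simp
  rw [hlin] at hα
  have hwt := hA _ (C.add_mem hu (C.smul_mem α hv))
  have hku := rankWt_add_finrank_ker Fq K u
  have hkv := rankWt_add_finrank_ker Fq K v
  have hkw := rankWt_add_finrank_ker Fq K (u + α • v)
  have hinf := finrank_rsupp_inf_add_finrank_ker_sup Fq K u v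
  rw [hα] at hkw
  rw [rsupp_eq_map_dualAnnihilator, rsupp_eq_map_dualAnnihilator] at hne
  set A := LinearMap.ker (Fintype.linearCombination Fq u)
  set B := LinearMap.ker (Fintype.linearCombination Fq v)
  have hsum := Submodule.finrank_sup_add_finrank_inf_eq A B
  have hlt : Module.finrank Fq ↥(A ⊓ B) < Module.finrank Fq A := by
    refine Submodule.finrank_lt_finrank_of_lt (inf_le_left.lt_of_ne fun h => hne ?_)
    rw [Submodule.eq_of_le_of_finrank_eq (inf_eq_left.mp h) (by omega)]
  have hle : Module.finrank Fq ↥(rsupp Fq K u ⊓ rsupp Fq K v) + 2 ≤ d := by omega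
  refine ⟨by omega, fun W hW hWuv => ?_⟩
  have := Submodule.finrank_mono (le_inf hWuv.1 hWuv.2)
  omega
end

section
/- Let q be a prime power, d ≥ 2, 2d ≤ m, and let C ≤ F_{q^m}^{2d} be an F_{q^m}-linear code of dimension d whose minimum rank distance is d and whose dual C^⊥ (with respect to the standard inner product) also has minimum rank distance d, and assume C has no codeword of rank weight d+1 (A_{d+1}(C) = 0). Then d+1 is a prime number. -/
open Polynomial

/-- The repunit `1 + q + ⋯ + q ^ (a - 1)` in base `q`, the `q`-analogue of `a`. -/
def repunit (q a : ℕ) : ℕ := ∑ i ∈ Finset.range a, q ^ i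

theorem repunit_mul_sub_one {q : ℕ} (hq : 2 ≤ q) (a : ℕ) :
    repunit q a * (q - 1) = q ^ a - 1 := by
  rw [repunit, Nat.geomSum_eq hq]
  exact Nat.div_mul_cancel (Nat.sub_one_dvd_pow_sub_one q a)

theorem repunit_coprime {q a b : ℕ} (hq : 2 ≤ q) (hab : a.Coprime b) :
    (repunit q a).Coprime (repunit q b) := by
  have h := Nat.pow_sub_one_gcd_pow_sub_one q a b
  rw [← repunit_mul_sub_one hq, ← repunit_mul_sub_one hq, Nat.gcd_mul_right, hab.gcd_eq_one,
    pow_one] at h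
  exact Nat.eq_of_mul_eq_mul_right (by omega : 0 < q - 1) (by rw [h, one_mul])

theorem one_lt_repunit {q r : ℕ} (hq : 2 ≤ q) (hr : 2 ≤ r) : 1 < repunit q r := by
  have h := repunit_mul_sub_one hq r
  by_contra! hle
  have h1 : repunit q r * (q - 1) ≤ 1 * (q - 1) := Nat.mul_le_mul_right _ hle
  have h2 : q ^ 1 < q ^ r := Nat.pow_lt_pow_right (by omega) (by omega)
  rw [pow_one] at h2
  omega

theorem pow_sub_pow_eq_repunit {q a i : ℕ} (hq : 2 ≤ q) (hi : i ≤ a) :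
    q ^ a - q ^ i = (q ^ i * (q - 1)) * repunit q (a - i) := by
  rw [mul_assoc, mul_comm (q - 1), repunit_mul_sub_one hq, Nat.mul_sub, mul_one, ← pow_add,
    Nat.add_sub_cancel' hi]

theorem not_prod_pow_sub_pow_dvd {q r N : ℕ} (hq : 2 ≤ q) (hr : r.Prime) (hN : r ∣ N) :
    ¬ (∏ i : Fin (r - 1), (q ^ r - q ^ i.val)) ∣
      ∏ i : Fin (r - 1), (q ^ (N + r - 1) - q ^ i.val) := by
  intro h
  have hr2 := hr.two_le
  have hfac (a : ℕ) (ha : r - 1 ≤ a) : ∏ i : Fin (r - 1), (q ^ a - q ^ i.val) =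
      (∏ i : Fin (r - 1), q ^ i.val * (q - 1)) * ∏ i : Fin (r - 1), repunit q (a - i) := by
    rw [← Finset.prod_mul_distrib]
    exact Finset.prod_congr rfl fun i _ => pow_sub_pow_eq_repunit hq (i.isLt.le.trans ha)
  rw [hfac r (by omega), hfac (N + r - 1) (by omega)] at h
  have h1 := Nat.dvd_of_mul_dvd_mul_left
    (Finset.prod_pos fun i _ => Nat.mul_pos (Nat.pow_pos (by omega)) (by omega)) h
  have h2 : repunit q r ∣ ∏ i : Fin (r - 1), repunit q (N + r - 1 - i) :=
    (Finset.dvd_prod_of_mem (fun i : Fin (r - 1) => repunit q (r - i))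
      (Finset.mem_univ (⟨0, by omega⟩ : Fin (r - 1)))).trans h1
  have h3 : (repunit q r).Coprime (∏ i : Fin (r - 1), repunit q (N + r - 1 - i)) := by
    refine Nat.Coprime.prod_right fun i _ => repunit_coprime hq ?_
    rw [hr.coprime_iff_not_dvd]
    intro hd
    have hd' : r ∣ N + (r - 1 - i) := by
      convert hd using 1; omega
    have := Nat.le_of_dvd (by omega) ((Nat.dvd_add_right hN).1 hd')
    omega
  have := Nat.Coprime.eq_one_of_dvd h3 h2
  have := one_lt_repunit hq hr2
  omega

/-- If every `t`-dimensional subspace lies in a unique block and every block has dimension `k`,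
then the number of ordered `t`-frames of a block divides the number of those of the space. -/
theorem prod_dvd_of_existsUnique_block {F W : Type} [Field F] [Fintype F] [AddCommGroup W]
    [Module F W] [Finite W] {t k : ℕ} (htk : t ≤ k) (htn : t ≤ Module.finrank F W)
    (B : Set (Submodule F W)) (hk : ∀ b ∈ B, Module.finrank F b = k)
    (hB : ∀ T : Submodule F W, Module.finrank F T = t → ∃! b, b ∈ B ∧ T ≤ b) :
    (∏ i : Fin t, (Fintype.card F ^ k - Fintype.card F ^ i.val)) ∣
      ∏ i : Fin t, (Fintype.card F ^ Module.finrank F W - Fintype.card F ^ i.val) := by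
  classical
  rw [← card_linearIndependent htn]
  have hX (s : {s : Fin t → W // LinearIndependent F s}) :
      ∃! b, b ∈ B ∧ Submodule.span F (Set.range s.1) ≤ b :=
    hB _ (by rw [finrank_span_eq_card s.2, Fintype.card_fin])
  choose β hβ hβu using hX
  let f (s : {s : Fin t → W // LinearIndependent F s}) : B := ⟨β s, (hβ s).1⟩
  have hfiber (b : B) : Nat.card {s // f s = b} =
      ∏ i : Fin t, (Fintype.card F ^ k - Fintype.card F ^ i.val) := by
    rw [← hk b b.2, ← card_linearIndependent (by rw [hk b b.2]; exact htk)]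
    refine Nat.card_congr ⟨fun s => ⟨fun i => ⟨s.1.1 i, ?_⟩, ?_⟩,
      fun s => ⟨⟨fun i => (s.1 i : W), ?_⟩, ?_⟩, fun s => rfl, fun s => rfl⟩
    · have h := (hβ s.1).2 (Submodule.subset_span ⟨i, rfl⟩)
      have hs : β s.1 = b := congrArg Subtype.val s.2
      rwa [hs] at h
    · exact LinearIndependent.of_comp b.1.subtype s.1.2
    · exact s.2.map' b.1.subtype b.1.ker_subtype
    · refine Subtype.ext (hβu _ _ ⟨b.2, ?_⟩).symm
      rw [Submodule.span_le]
      rintro _ ⟨i, rfl⟩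
      exact (s.1 i).2
  have : Fintype B := Fintype.ofFinite B
  rw [Nat.card_congr (Equiv.sigmaFiberEquiv f).symm, Nat.card_sigma,
    Finset.sum_congr rfl fun b _ => hfiber b, Finset.sum_const]
  exact ⟨_, by rw [smul_eq_mul, mul_comm]⟩

theorem finrank_comap_mkQ {F V : Type} [Field F] [AddCommGroup V] [Module F V]
    [FiniteDimensional F V] (U : Submodule F V) (P : Submodule F (V ⧸ U)) :
    Module.finrank F (P.comap U.mkQ) = Module.finrank F P + Module.finrank F U := by
  have h := LinearMap.finrank_range_add_finrank_ker (U.mkQ.domRestrict (P.comap U.mkQ))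
  have hU : U ≤ P.comap U.mkQ := U.le_comap_mkQ P
  rw [LinearMap.range_domRestrict, Submodule.map_comap_eq_of_surjective U.mkQ_surjective,
    LinearMap.ker_domRestrict, Submodule.ker_mkQ,
    (Submodule.comapSubtypeEquivOfLe hU).finrank_eq] at h
  exact h.symm

/-- The divisibility conditions of a `q`-Steiner system, in terms of the derived systems. -/
theorem IsSteinerSystemQ.prod_dvd {F : Type} [Field F] [Fintype F] {t k n s : ℕ}
    {B : Set (Submodule F (Fin n → F))} (hB : IsSteinerSystemQ F t k n B) (hst : s ≤ t)
    (htk : t ≤ k) (hkn : k ≤ n) :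
    (∏ i : Fin (t - s), (Fintype.card F ^ (k - s) - Fintype.card F ^ i.val)) ∣
      ∏ i : Fin (t - s), (Fintype.card F ^ (n - s) - Fintype.card F ^ i.val) := by
  obtain ⟨u, hu⟩ := exists_linearIndependent_of_le_finrank (R := F) (M := Fin n → F) (n := s)
    (by rw [Module.finrank_fin_fun]; omega)
  obtain ⟨U, hU⟩ : ∃ U : Submodule F (Fin n → F), Module.finrank F U = s :=
    ⟨_, by rw [finrank_span_eq_card hu, Fintype.card_fin]⟩
  have hq : Module.finrank F ((Fin n → F) ⧸ U) = n - s := by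
    have := U.finrank_quotient_add_finrank
    rw [Module.finrank_fin_fun] at this
    omega
  have : Finite ((Fin n → F) ⧸ U) := Finite.of_surjective _ U.mkQ_surjective
  rw [← hq]
  refine prod_dvd_of_existsUnique_block (by omega) (by omega) {b | b.comap U.mkQ ∈ B} ?_ ?_
  · intro b hb
    have := hB.1 _ hb
    rw [finrank_comap_mkQ] at this
    omega
  · intro T hT
    obtain ⟨b, ⟨hb, hTb⟩, hbu⟩ := hB.2 (T.comap U.mkQ) (by rw [finrank_comap_mkQ]; omega)
    have hc : (b.map U.mkQ).comap U.mkQ = b := by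
      rw [Submodule.comap_map_mkQ, sup_eq_right]
      exact (U.le_comap_mkQ T).trans hTb
    refine ⟨b.map U.mkQ, ⟨by simpa only [Set.mem_ofPred_eq, hc] using hb, ?_⟩, ?_⟩
    · rw [← Submodule.map_comap_eq_of_surjective U.mkQ_surjective T]
      exact Submodule.map_mono hTb
    · rintro b' ⟨hb', hTb'⟩
      rw [← hbu _ ⟨hb', Submodule.comap_mono hTb'⟩,
        Submodule.map_comap_eq_of_surjective U.mkQ_surjective]

theorem exists_generator_ker_of_surjective {K V W : Type} [Field K] [AddCommGroup V] [Module K V]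
    [FiniteDimensional K V] [AddCommGroup W] [Module K W] {f : V →ₗ[K] W}
    (hf : Function.Surjective f) (h : Module.finrank K V = Module.finrank K W + 1) :
    ∃ v ≠ 0, f v = 0 ∧ ∀ w, f w = 0 → ∃ a : K, a • v = w := by
  have hker : Module.finrank K (LinearMap.ker f) = 1 := by
    have := LinearMap.finrank_range_add_finrank_ker f
    rw [LinearMap.range_eq_top.2 hf, finrank_top] at this
    omega
  obtain ⟨v, hv, hgen⟩ := finrank_eq_one_iff'.1 hker
  refine ⟨v, fun h => hv (Subtype.ext h), v.2, fun w hw => ?_⟩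
  obtain ⟨a, ha⟩ := hgen ⟨w, hw⟩
  exact ⟨a, congrArg Subtype.val ha⟩

theorem mem_dualCode {K : Type} [Field K] {n : ℕ} {C : Submodule K (Fin n → K)}
    {v : Fin n → K} : v ∈ dualCode K C ↔ ∀ u ∈ C, ∑ i, u i * v i = 0 := by
  simp [dualCode, dotL, Submodule.mem_iInf]

section Code

variable {Fq K : Type} [Field Fq] [Field K] [Algebra Fq K] {n : ℕ}

theorem finrank_ker_linearCombination_add_rankWt (c : Fin n → K) :
    Module.finrank Fq (LinearMap.ker (Fintype.linearCombination Fq c)) + rankWt Fq K c = n := by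
  have h := LinearMap.finrank_range_add_finrank_ker (Fintype.linearCombination Fq c)
  rw [Fintype.range_linearCombination, Module.finrank_fin_fun] at h
  rw [rankWt, add_comm, h]

/-- The linear map sending `c` to its products with the vectors `t j` over the base field. -/
def evalFamily (K : Type) [Field K] [Algebra Fq K] {k : ℕ} (t : Fin k → Fin n → Fq) :
    (Fin n → K) →ₗ[K] (Fin k → K) :=
  LinearMap.pi fun j => dotL K fun i => algebraMap Fq K (t j i)

theorem evalFamily_apply {k : ℕ} (t : Fin k → Fin n → Fq) (c : Fin n → K) (j : Fin k) :
    evalFamily K t c j = Fintype.linearCombination Fq c (t j) := by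
  simp [evalFamily, dotL, Fintype.linearCombination_apply, Algebra.smul_def]

theorem evalFamily_eq_zero_iff {k : ℕ} (t : Fin k → Fin n → Fq) (c : Fin n → K) :
    evalFamily K t c = 0 ↔
      Submodule.span Fq (Set.range t) ≤ LinearMap.ker (Fintype.linearCombination Fq c) := by
  rw [Submodule.span_le, Set.range_subset_iff, funext_iff]
  simp only [evalFamily_apply, Pi.zero_apply, SetLike.mem_coe, LinearMap.mem_ker]

theorem eq_zero_of_sum_smul_eq_zero {k : ℕ} {t : Fin k → Fin n → Fq}
    (ht : LinearIndependent Fq t) {a : Fin k → K} (h : ∀ i, ∑ j, t j i • a j = 0) : a = 0 := by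
  funext j
  refine (Module.forall_dual_apply_eq_zero_iff Fq _).1 fun f => ?_
  refine Fintype.linearIndependent_iff.1 ht (fun j => f (a j)) ?_ j
  funext i
  simpa [mul_comm] using congrArg f (h i)

theorem rankWt_sum_smul_le {k : ℕ} (t : Fin k → Fin n → Fq) (a : Fin k → K) :
    rankWt Fq K (fun i => ∑ j, t j i • a j) ≤ k := by
  have hle : Submodule.span Fq (Set.range fun i => ∑ j, t j i • a j) ≤
      Submodule.span Fq (Set.range a) := by
    rw [Submodule.span_le]
    rintro _ ⟨i, rfl⟩
    exact Submodule.sum_mem _ fun j _ =>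
      Submodule.smul_mem _ _ (Submodule.subset_span ⟨j, rfl⟩)
  have := FiniteDimensional.span_of_finite Fq (Set.finite_range a)
  exact (Submodule.finrank_mono hle).trans ((finrank_range_le_card a).trans_eq (Fintype.card_fin k))

theorem evalFamily_domRestrict_surjective {k d : ℕ} {C : Submodule K (Fin n → K)}
    (hmin' : IsMinRankDist Fq K (dualCode K C) d) (hk : k < d) {t : Fin k → Fin n → Fq}
    (ht : LinearIndependent Fq t) : Function.Surjective ((evalFamily K t).domRestrict C) := by
  rw [← LinearMap.range_eq_top]
  by_contra hne
  obtain ⟨φ, hφ, hle⟩ := Submodule.exists_le_ker_of_lt_top _ (lt_top_iff_ne_top.2 hne)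
  let a : Fin k → K := fun j => φ (Pi.single j 1)
  have hφa (x : Fin k → K) : φ x = ∑ j, x j * a j := by
    conv_lhs => rw [pi_eq_sum_univ' x]
    simp [a, map_sum]
  let v : Fin n → K := fun i => ∑ j, t j i • a j
  have hv0 : v ≠ 0 := by
    intro hv
    have ha := eq_zero_of_sum_smul_eq_zero ht fun i => congrFun hv i
    exact hφ (LinearMap.ext fun x => by simp [hφa, ha])
  have hv : v ∈ dualCode K C := by
    rw [mem_dualCode]
    intro u hu
    have h : φ (evalFamily K t u) = 0 := hle ⟨⟨u, hu⟩, rfl⟩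
    rw [hφa] at h
    rw [← h]
    simp only [v, evalFamily_apply, Fintype.linearCombination_apply, Algebra.smul_def,
      Finset.mul_sum, Finset.sum_mul]
    rw [Finset.sum_comm]
    exact Finset.sum_congr rfl fun j _ => Finset.sum_congr rfl fun i _ => by ring
  have h1 := hmin'.2 v hv hv0
  have h2 : rankWt Fq K v ≤ k := rankWt_sum_smul_le t a
  omega

/-- The orthogonal complements of the supports of the minimum weight codewords form a
`q`-Steiner system. -/
theorem isSteinerSystemQ_of_dually_AMRD {d : ℕ} (hd : 1 ≤ d) {C : Submodule K (Fin (2 * d) → K)}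
    (hdim : Module.finrank K C = d) (hmin : IsMinRankDist Fq K C d)
    (hmin' : IsMinRankDist Fq K (dualCode K C) d) (hA : ∀ c ∈ C, rankWt Fq K c ≠ d + 1) :
    IsSteinerSystemQ Fq (d - 1) d (2 * d)
      {b | ∃ c ∈ C, rankWt Fq K c = d ∧
        b = LinearMap.ker (Fintype.linearCombination Fq c)} := by
  constructor
  · rintro _ ⟨c, -, hc, rfl⟩
    have := finrank_ker_linearCombination_add_rankWt (Fq := Fq) c
    omega
  · intro W hW
    let β := Module.finBasisOfFinrankEq Fq W hW
    let t : Fin (d - 1) → Fin (2 * d) → Fq := fun j => β j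
    have ht : LinearIndependent Fq t := β.linearIndependent.map' W.subtype W.ker_subtype
    have hspan : Submodule.span Fq (Set.range t) = W := by
      have h := congrArg (Submodule.map W.subtype) β.span_eq
      rwa [Submodule.map_span, ← Set.range_comp, Submodule.map_subtype_top] at h
    obtain ⟨⟨c, hcC⟩, hc0, hc, hgen⟩ := exists_generator_ker_of_surjective
      (evalFamily_domRestrict_surjective hmin' (by omega) ht)
      (by rw [hdim, Module.finrank_fin_fun]; omega)
    have hc0' : c ≠ 0 := fun h => hc0 (Subtype.ext h)
    have hWc : W ≤ LinearMap.ker (Fintype.linearCombination Fq c) := by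
      rw [← hspan, ← evalFamily_eq_zero_iff]
      exact hc
    have hwt : rankWt Fq K c = d := by
      have h1 := Submodule.finrank_mono hWc
      have h2 := finrank_ker_linearCombination_add_rankWt (Fq := Fq) c
      have h3 := hmin.2 c hcC hc0'
      have h4 := hA c hcC
      omega
    refine ⟨_, ⟨⟨c, hcC, hwt, rfl⟩, hWc⟩, ?_⟩
    rintro _ ⟨⟨c', hcC', hwt', rfl⟩, hWc'⟩
    rw [← hspan, ← evalFamily_eq_zero_iff] at hWc'
    obtain ⟨a, ha⟩ := hgen ⟨c', hcC'⟩ hWc'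
    have ha' : c' = a • c := (congrArg Subtype.val ha).symm
    have ha0 : a ≠ 0 := by
      rintro rfl
      have h0 : rankWt Fq K c' = 0 := by
        rw [ha', zero_smul, rankWt,
          Submodule.span_eq_bot.2 (by rintro _ ⟨i, rfl⟩; rfl), finrank_bot]
      omega
    ext w
    have : Fintype.linearCombination Fq c' w = a * Fintype.linearCombination Fq c w := by
      simp [ha', Fintype.linearCombination_apply, Finset.mul_sum]
    simp [LinearMap.mem_ker, this, ha0]

end Code

/-- For a `[2d,d,d]` dually AMRD code with no codewords of rank
weight `d+1`, the number `d+1` is prime. -/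
theorem succ_prime_of_dually_AMRD
    (Fq K : Type) [Field Fq] [Fintype Fq] [Field K] [Fintype K] [Algebra Fq K]
    (m d : ℕ) (hd2 : 2 ≤ d) (hm : Module.finrank Fq K = m) (hdm : 2 * d ≤ m)
    (C : Submodule K (Fin (2 * d) → K)) (hdim : Module.finrank K C = d)
    (hmin : IsMinRankDist Fq K C d)
    (hmin' : IsMinRankDist Fq K (dualCode K C) d)
    (hA : ∀ c ∈ C, rankWt Fq K c ≠ d + 1) :
    Nat.Prime (d + 1) := by
  by_contra hp
  obtain ⟨r, hr, hrd⟩ := Nat.exists_prime_and_dvd (n := d + 1) (by omega)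
  have hr2 := hr.two_le
  have hrle : r ≤ d := by
    have h1 := Nat.le_of_dvd (by omega) hrd
    have h2 : r ≠ d + 1 := fun h => hp (h ▸ hr)
    omega
  have h := (isSteinerSystemQ_of_dually_AMRD (by omega) hdim hmin hmin' hA).prod_dvd
    (s := d - r) (by omega) (by omega) (by omega)
  have e1 : d - 1 - (d - r) = r - 1 := by omega
  have e2 : d - (d - r) = r := by omega
  have e3 : 2 * d - (d - r) = d + 1 + r - 1 := by omega
  rw [e1, e2, e3] at h
  exact not_prod_pow_sub_pow_dvd Fintype.one_lt_card hr hrd h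
end

section
/- Let q be a prime power, let d be a positive natural number, and let p be a prime dividing d+1 with p ≠ d+1. Then [p choose 1]_q = (q^p−1)/(q−1) = Φ_p(q) does not divide the Gaussian binomial coefficient [d+p choose p−1]_q. -/
open Polynomial

/-- The Gaussian binomial coefficient as an integer polynomial, defined by the `q`-Pascal rule. -/
noncomputable def gaussPoly : ℕ → ℕ → ℤ[X]
  | _, 0 => 1
  | 0, _ + 1 => 0
  | a + 1, b + 1 => gaussPoly a b + X ^ (b + 1) * gaussPoly a (b + 1)

theorem gaussPoly_mul_prod (a b : ℕ) :
    gaussPoly a b * ∏ i ∈ Finset.range b, (X ^ (i + 1) - 1) =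
      ∏ i ∈ Finset.range b, (X ^ (a - i) - 1) := by
  induction a generalizing b with
  | zero =>
    cases b with
    | zero => simp [gaussPoly]
    | succ b => simp [gaussPoly, Finset.prod_range_succ]
  | succ a ih =>
    cases b with
    | zero => simp [gaussPoly]
    | succ b =>
      have h₁ := ih b
      have h₂ := ih (b + 1)
      have h₃ : ∏ i ∈ Finset.range (b + 1), ((X : ℤ[X]) ^ (a + 1 - i) - 1) =
          (∏ i ∈ Finset.range b, (X ^ (a - i) - 1)) * (X ^ (a + 1) - 1) := by
        rw [Finset.prod_range_succ']
        simp
      rw [h₃]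
      rw [Finset.prod_range_succ] at h₂ ⊢
      rw [Finset.prod_range_succ (fun i => (X : ℤ[X]) ^ (a - i) - 1)] at h₂
      rw [gaussPoly]
      by_cases hba : b ≤ a
      · have hX : (X : ℤ[X]) ^ (a + 1) = X ^ (b + 1) * X ^ (a - b) := by
          rw [← pow_add]
          congr 1
          omega
        rw [hX]
        linear_combination (X ^ (b + 1) - 1) * h₁ + X ^ (b + 1) * h₂
      · have h₀ : ∏ i ∈ Finset.range b, ((X : ℤ[X]) ^ (a - i) - 1) = 0 :=
          Finset.prod_eq_zero (Finset.mem_range.2 (not_le.1 hba)) (by simp)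
        rw [h₀] at h₁ h₂ ⊢
        linear_combination (X ^ (b + 1) - 1) * h₁ + X ^ (b + 1) * h₂

theorem gaussBinom_eq_eval_gaussPoly {q : ℕ} (hq : 2 ≤ q) {a b : ℕ} (hba : b ≤ a) :
    (gaussBinom q a b : ℤ) = (gaussPoly a b).eval (q : ℤ) := by
  have h := congrArg (eval (q : ℤ)) (gaussPoly_mul_prod a b)
  simp only [eval_mul, eval_prod, eval_sub, eval_pow, eval_X, eval_one] at h
  have hcast (n : ℕ) : ((q ^ n - 1 : ℕ) : ℤ) = (q : ℤ) ^ n - 1 := by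
    rw [Nat.cast_sub (Nat.one_le_pow _ _ (by omega))]
    simp
  have hne : ∏ i ∈ Finset.range b, ((q : ℤ) ^ (i + 1) - 1) ≠ 0 := by
    refine Finset.prod_ne_zero_iff.2 fun i _ => sub_ne_zero.2 ?_
    exact (one_lt_pow₀ (by exact_mod_cast hq) (Nat.succ_ne_zero i)).ne'
  rw [gaussBinom, if_pos hba]
  simp only [Int.natCast_ediv, Nat.cast_prod, hcast]
  rw [← h, Int.mul_ediv_cancel _ hne]

/-- A special case of the `q`-Lucas theorem. -/
theorem cyclotomic_dvd_gaussPoly_sub_one {p : ℕ} (hp : 0 < p) (m : ℕ) :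
    cyclotomic p ℤ ∣ gaussPoly (m * p + (p - 1)) (p - 1) - 1 := by
  have hζ := Complex.isPrimitiveRoot_exp p hp.ne'
  set ζ := Complex.exp (2 * Real.pi * Complex.I / p)
  rw [cyclotomic_eq_minpoly hζ hp]
  refine minpoly.isIntegrallyClosed_dvd (hζ.isIntegral hp) ?_
  have h := congrArg (aeval ζ) (gaussPoly_mul_prod (m * p + (p - 1)) (p - 1))
  simp only [map_mul, map_prod, map_sub, map_pow, aeval_X, map_one] at h
  have hprod : ∏ i ∈ Finset.range (p - 1), (ζ ^ (m * p + (p - 1) - i) - 1) =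
      ∏ i ∈ Finset.range (p - 1), (ζ ^ (i + 1) - 1) := by
    rw [← Finset.prod_range_reflect]
    refine Finset.prod_congr rfl fun i hi => ?_
    have hi := Finset.mem_range.1 hi
    have he : m * p + (p - 1) - (p - 1 - 1 - i) = p * m + (i + 1) := by
      rw [mul_comm p m]
      omega
    rw [he, pow_add, pow_mul, hζ.pow_eq_one, one_pow, one_mul]
  have hne : ∏ i ∈ Finset.range (p - 1), (ζ ^ (i + 1) - 1) ≠ 0 := by
    refine Finset.prod_ne_zero_iff.2 fun i hi => sub_ne_zero.2 ?_
    have hi := Finset.mem_range.1 hi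
    exact hζ.pow_ne_one_of_pos_of_lt (Nat.succ_ne_zero i) (by omega)
  rw [hprod] at h
  rw [map_sub, map_one, sub_eq_zero]
  exact mul_right_cancel₀ hne (h.trans (one_mul _).symm)

/-- If `p` is a prime dividing `d+1` with `p ≠ d+1`, then
`[p choose 1]_q = (q^p−1)/(q−1) = Φ_p(q)` does not divide `[d+p choose p−1]_q`. -/
theorem gaussBinom_p_one_not_dvd (q : ℕ) (hq : IsPrimePow q)
    (d : ℕ) (hd : 0 < d) (p : ℕ) (hp : p.Prime) (hpd : p ∣ d + 1) (hne : p ≠ d + 1) :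
    gaussBinom q p 1 = (q ^ p - 1) / (q - 1) ∧
      (gaussBinom q p 1 : ℤ) = (Polynomial.cyclotomic p ℤ).eval (q : ℤ) ∧
      ¬ gaussBinom q p 1 ∣ gaussBinom q (d + p) (p - 1) := by
  have hq2 : 2 ≤ q := hq.two_le
  have hp1 := hp.one_lt
  have h₁ : gaussBinom q p 1 = (q ^ p - 1) / (q - 1) := by
    simp [gaussBinom, hp1.le]
  have h₂ : (gaussBinom q p 1 : ℤ) = (cyclotomic p ℤ).eval (q : ℤ) := by
    have := Fact.mk hp
    rw [h₁, ← Nat.geomSum_eq hq2, cyclotomic_prime]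
    simp [eval_finsetSum]
  refine ⟨h₁, h₂, fun hdvd => ?_⟩
  obtain ⟨m, hm⟩ := hpd
  have ha : d + p = m * p + (p - 1) := by
    rw [mul_comm m p]
    omega
  have hc := eval_dvd (x := (q : ℤ)) (cyclotomic_dvd_gaussPoly_sub_one hp.pos m)
  rw [eval_sub, eval_one, ← ha, ← gaussBinom_eq_eval_gaussPoly hq2 (by omega), ← h₂] at hc
  have hone : gaussBinom q p 1 = 1 := by
    have := (dvd_sub_right (Int.natCast_dvd_natCast.2 hdvd)).1 hc
    exact Nat.dvd_one.1 (by exact_mod_cast this)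
  rw [h₁, ← Nat.geomSum_eq hq2] at hone
  have hle : ∑ i ∈ Finset.range 2, q ^ i ≤ ∑ i ∈ Finset.range p, q ^ i :=
    Finset.sum_le_sum_of_subset (Finset.range_mono hp1)
  simp [Finset.sum_range_succ] at hle
  omega
end

section
/- Let q be a prime power, let d be a positive natural number, and let p be a prime dividing d+1 with p ≠ d+1. Then no q-Steiner system S_q(p−1, p, d+p) exists. -/
open Polynomial

/-- Double counting of linearly independent `t`-tuples in a `q`-Steiner system. -/
theorem IsSteinerSystemQ.card_mul_prod {Fq : Type} [Field Fq] [Fintype Fq] {t k n : ℕ}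
    {B : Set (Submodule Fq (Fin n → Fq))} (hB : IsSteinerSystemQ Fq t k n B)
    (htk : t ≤ k) (htn : t ≤ n) :
    Nat.card B * ∏ i : Fin t, (Fintype.card Fq ^ k - Fintype.card Fq ^ (i : ℕ)) =
      ∏ i : Fin t, (Fintype.card Fq ^ n - Fintype.card Fq ^ (i : ℕ)) := by
  classical
  have hblock (b : B) : Nat.card {s : Fin t → b.1 // LinearIndependent Fq s} =
      ∏ i : Fin t, (Fintype.card Fq ^ k - Fintype.card Fq ^ (i : ℕ)) := by
    have hb := hB.1 b.1 b.2
    rw [card_linearIndependent (by rw [hb]; exact htk), hb]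
  have htotal : Nat.card {s : Fin t → (Fin n → Fq) // LinearIndependent Fq s} =
      ∏ i : Fin t, (Fintype.card Fq ^ n - Fintype.card Fq ^ (i : ℕ)) := by
    rw [card_linearIndependent (by simpa using htn), Module.finrank_fin_fun]
  let f : (Σ b : B, {s : Fin t → b.1 // LinearIndependent Fq s}) →
      {s : Fin t → (Fin n → Fq) // LinearIndependent Fq s} :=
    fun x => ⟨fun i => (x.2.1 i : Fin n → Fq),
      x.2.2.map' x.1.1.subtype (Submodule.ker_subtype _)⟩
  have hspan (s : {s : Fin t → (Fin n → Fq) // LinearIndependent Fq s}) :=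
    hB.2 (Submodule.span Fq (Set.range s.1)) (by simpa using finrank_span_eq_card s.2)
  have hf : Function.Bijective f := by
    constructor
    · intro x y hxy
      have hmem (z) : z.1.1 ∈ B ∧ Submodule.span Fq (Set.range (f z).1) ≤ z.1.1 := by
        refine ⟨z.1.2, Submodule.span_le.2 ?_⟩
        rintro _ ⟨i, rfl⟩
        exact (z.2.1 i).2
      have hb : x.1 = y.1 :=
        Subtype.ext ((hspan (f x)).unique (hmem x) (hxy ▸ hmem y))
      obtain ⟨b, s, hs⟩ := x
      obtain ⟨b', s', hs'⟩ := y
      obtain rfl : b = b' := hb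
      have hss : s = s' := by
        funext i
        exact Subtype.ext (congrFun (congrArg Subtype.val hxy) i)
      subst hss
      rfl
    · intro s
      obtain ⟨b, ⟨hb, hle⟩, -⟩ := hspan s
      have hs (i) : s.1 i ∈ b := hle (Submodule.subset_span ⟨i, rfl⟩)
      exact ⟨⟨⟨b, hb⟩, fun i => ⟨s.1 i, hs i⟩, LinearIndependent.of_comp b.subtype s.2⟩, rfl⟩
  have := Fintype.ofFinite B
  rw [← htotal, ← Nat.card_eq_of_bijective f hf, Nat.card_sigma]
  simp only [hblock, Finset.sum_const, Finset.card_univ, Nat.card_eq_fintype_card, smul_eq_mul]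

theorem Nat.pow_sub_one_eq_mul_geom_sum {q : ℕ} (hq : 1 ≤ q) (a : ℕ) :
    q ^ a - 1 = (q - 1) * ∑ i ∈ Finset.range a, q ^ i := by
  zify [hq, Nat.one_le_pow a q hq]
  exact (mul_geom_sum (q : ℤ) a).symm

/-- The `q`-analogues `1 + q + ⋯ + q ^ (a - 1)` of coprime numbers are coprime. -/
theorem Nat.Coprime.geom_sum {q a b : ℕ} (hq : 2 ≤ q) (hab : a.Coprime b) :
    (∑ i ∈ Finset.range a, q ^ i).Coprime (∑ i ∈ Finset.range b, q ^ i) := by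
  have h := Nat.pow_sub_one_gcd_pow_sub_one q a b
  rw [hab.gcd_eq_one, pow_one, Nat.pow_sub_one_eq_mul_geom_sum (by omega),
    Nat.pow_sub_one_eq_mul_geom_sum (by omega), Nat.gcd_mul_left] at h
  exact Nat.eq_of_mul_eq_mul_left (show 0 < q - 1 by omega) (h.trans (mul_one _).symm)

/-- If `p` is a prime dividing `d+1` with `p ≠ d+1`, then no
`q`-Steiner system `S_q(p−1, p, d+p)` exists. -/
theorem no_steiner_system
    (Fq : Type) [Field Fq] [Fintype Fq]
    (d : ℕ) (hd : 0 < d) (p : ℕ) (hp : p.Prime) (hpd : p ∣ d + 1) (hne : p ≠ d + 1) :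
    ¬ ∃ B : Set (Submodule Fq (Fin (d + p) → Fq)),
        IsSteinerSystemQ Fq (p - 1) p (d + p) B := by
  rintro ⟨B, hB⟩
  set q := Fintype.card Fq with hq_def
  have hq : 2 ≤ q := Fintype.one_lt_card
  have hp2 := hp.two_le
  have hcount := hB.card_mul_prod (by omega) (by omega)
  rw [← hq_def] at hcount
  have hfactor {m i : ℕ} (hi : i ≤ m) :
      q ^ m - q ^ i = (q - 1) * (q ^ i * ∑ j ∈ Finset.range (m - i), q ^ j) := by
    rw [mul_left_comm, ← Nat.pow_sub_one_eq_mul_geom_sum (by omega), Nat.mul_sub_one,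
      ← pow_add, Nat.add_sub_cancel' hi]
  have hleft : ∏ i : Fin (p - 1), (q ^ p - q ^ (i : ℕ)) =
      (q - 1) ^ (p - 1) *
        ∏ i : Fin (p - 1), (q ^ (i : ℕ) * ∑ j ∈ Finset.range (p - i), q ^ j) := by
    rw [Finset.prod_congr rfl fun i _ => hfactor (by omega), Finset.prod_mul_distrib]
    simp
  have hright : ∏ i : Fin (p - 1), (q ^ (d + p) - q ^ (i : ℕ)) =
      (q - 1) ^ (p - 1) *
        ∏ i : Fin (p - 1), (q ^ (i : ℕ) * ∑ j ∈ Finset.range (d + p - i), q ^ j) := by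
    rw [Finset.prod_congr rfl fun i _ => hfactor (by omega), Finset.prod_mul_distrib]
    simp
  rw [hleft, hright, mul_left_comm] at hcount
  have hcount' := Nat.eq_of_mul_eq_mul_left (pow_pos (by omega) _) hcount
  have hdvd : ∑ j ∈ Finset.range p, q ^ j ∣
      ∏ i : Fin (p - 1), (q ^ (i : ℕ) * ∑ j ∈ Finset.range (d + p - i), q ^ j) := by
    rw [← hcount']
    refine Dvd.dvd.mul_left ?_ _
    simpa using Finset.dvd_prod_of_mem
      (fun i : Fin (p - 1) => q ^ (i : ℕ) * ∑ j ∈ Finset.range (p - i), q ^ j)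
      (Finset.mem_univ ⟨0, by omega⟩)
  have hgt : 1 < ∑ j ∈ Finset.range p, q ^ j := by
    calc 1 < ∑ j ∈ Finset.range 2, q ^ j := by simp [Finset.sum_range_succ]; omega
      _ ≤ _ := Finset.sum_le_sum_of_subset (Finset.range_mono hp2)
  have hcop_q : (∑ j ∈ Finset.range p, q ^ j).Coprime q := by
    obtain ⟨r, rfl⟩ : ∃ r, p = r + 1 := ⟨p - 1, by omega⟩
    rw [Finset.sum_range_succ', Finset.sum_congr rfl fun j _ => pow_succ q j,
      ← Finset.sum_mul]
    simp
  refine hgt.ne' (Nat.Coprime.eq_one_of_dvd (Nat.Coprime.prod_right fun i _ => ?_) hdvd)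
  refine (hcop_q.pow_right _).mul_right (Nat.Coprime.geom_sum hq ?_)
  rw [hp.coprime_iff_not_dvd]
  intro h
  have h1 : p ∣ p - 1 - i := by
    refine (Nat.dvd_add_right hpd).1 ?_
    convert h using 1
    omega
  have := Nat.le_of_dvd (by omega) h1
  omega
end
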